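/- Let I ⊆ ℝ be an open interval and let h = (h₁,h₂), g = (g₁,g₂) : I → ℂ be smooth maps such that h'(r) ≠ 0, ⟨g'(r), i·h'(r)⟩ = 0, and D(r) := ⟨g(r), i·h'(r)⟩ = h₁'(r)g₂(r) − h₂'(r)g₁(r) > 0 for all r ∈ I. Define k := h'/D : I → ℂ. Then for every r ∈ I one has k'(r) = 0 if and only if h₁''(r)·h₂'(r) − h₁'(r)·h₂''(r) = 0. -/

import Mathlib

/-- The real inner product `⟨z,w⟩ = Re (z · conj w)` on `ℂ ≅ ℝ²`. -/
noncomputable def rinner (z w : ℂ) : ℝ := (z * (starRingEnd ℂ) w).re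

theorem rinner_I_mul (z w : ℂ) : rinner z (Complex.I * w) = z.im * w.re - z.re * w.im := by
  simp [rinner]

theorem hasDerivAt_rinner_I_mul {z w : ℝ → ℂ} {z' w' : ℂ} {r : ℝ}
    (hz : HasDerivAt z z' r) (hw : HasDerivAt w w' r) :
    HasDerivAt (fun s => rinner (z s) (Complex.I * w s))
      (rinner z' (Complex.I * w r) + rinner (z r) (Complex.I * w')) r := by
  have re {u : ℝ → ℂ} {u' : ℂ} (hu : HasDerivAt u u' r) :
      HasDerivAt (fun s => (u s).re) u'.re r :=
    Complex.reCLM.hasFDerivAt.comp_hasDerivAt r hu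
  have im {u : ℝ → ℂ} {u' : ℂ} (hu : HasDerivAt u u' r) :
      HasDerivAt (fun s => (u s).im) u'.im r :=
    Complex.imCLM.hasFDerivAt.comp_hasDerivAt r hu
  simp only [rinner_I_mul]
  refine (((im hz).mul (re hw)).sub ((re hz).mul (im hw))).congr_deriv ?_
  ring

/-- The quotient-rule numerator of `w / ⟨z, i·w⟩` where the derivative `v` of `w` is given and
the derivative of `z` is orthogonal to `i·w`. -/
theorem mul_rinner_sub_mul_rinner (z w v : ℂ) :
    v * (rinner z (Complex.I * w) : ℂ) - w * (rinner z (Complex.I * v) : ℂ) =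
      -z * ((v.re * w.im - w.re * v.im : ℝ) : ℂ) := by
  rw [rinner_I_mul, rinner_I_mul]
  apply Complex.ext
  · simp only [Complex.sub_re, Complex.re_mul_ofReal, Complex.neg_re]
    ring
  · simp only [Complex.sub_im, Complex.im_mul_ofReal, Complex.neg_im]
    ring

/-- for a stabilized pair `(h,g)` on an open interval, the
vector field `k := h'/D` with `D = ⟨g, i·h'⟩ > 0` has `k'(r) = 0` iff
`h₁''(r)·h₂'(r) − h₁'(r)·h₂''(r) = 0`. -/
theorem stmt14 (a b : ℝ) (h g : ℝ → ℂ)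
    (hh : ContDiffOn ℝ (⊤ : ℕ∞) h (Set.Ioo a b))
    (hg : ContDiffOn ℝ (⊤ : ℕ∞) g (Set.Ioo a b))
    (himm : ∀ r ∈ Set.Ioo a b, deriv h r ≠ 0)
    (horth : ∀ r ∈ Set.Ioo a b, rinner (deriv g r) (Complex.I * deriv h r) = 0)
    (hpos : ∀ r ∈ Set.Ioo a b, 0 < rinner (g r) (Complex.I * deriv h r)) :
    ∀ r ∈ Set.Ioo a b,
      (deriv (fun s => deriv h s / ((rinner (g s) (Complex.I * deriv h s) : ℝ) : ℂ)) r = 0 ↔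
        (deriv (deriv h) r).re * (deriv h r).im
          - (deriv h r).re * (deriv (deriv h) r).im = 0) := by
  intro r hr
  have hnhds : Set.Ioo a b ∈ nhds r := isOpen_Ioo.mem_nhds hr
  have hg' : HasDerivAt g (deriv g r) r :=
    ((hg.contDiffAt hnhds).differentiableAt (by simp)).hasDerivAt
  have hh' : HasDerivAt (deriv h) (deriv (deriv h) r) r :=
    (((hh.deriv_of_isOpen (m := 1) isOpen_Ioo
      (WithTop.coe_le_coe.mpr (le_top : (1 + 1 : ℕ∞) ≤ ⊤))).contDiffAt
      hnhds).differentiableAt one_ne_zero).hasDerivAt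
  have hD : (rinner (g r) (Complex.I * deriv h r) : ℂ) ≠ 0 :=
    Complex.ofReal_ne_zero.mpr (hpos r hr).ne'
  have hg0 : g r ≠ 0 := by
    intro h0
    simp [h0, rinner] at hD
  have hk := hh'.div (hasDerivAt_rinner_I_mul hg' hh').ofReal_comp hD
  rw [horth r hr, zero_add, mul_rinner_sub_mul_rinner] at hk
  rw [show deriv (fun s => deriv h s / ((rinner (g s) (Complex.I * deriv h s) : ℝ) : ℂ)) r = _
    from hk.deriv]
  rw [div_eq_zero_iff, or_iff_left (pow_ne_zero 2 hD), mul_eq_zero,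
    or_iff_right (neg_ne_zero.mpr hg0), Complex.ofReal_eq_zero]
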